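/- Let Y be an irreducible scheme of finite type over a field k, and let f : X → Y be a morphism of finite type with X nonempty. Suppose that for every z ∈ X, dim_z(X) − dim_{f(z)}(Y) = dim_z(f⁻¹(f(z))). Then there exists an open dense subset U ⊆ Y such that for every y ∈ U, the fiber f⁻¹(y) is nonempty. -/

import Mathlib

open AlgebraicGeometry CategoryTheory Topology

/-- The local dimension of a topological space at a point: the supremum of the
Krull dimensions of the irreducible components containing the point. -/
noncomputable def localDim (X : Type*) [TopologicalSpace X] (z : X) : WithBot ℕ∞ :=
  ⨆ C ∈ {C ∈ irreducibleComponents X | z ∈ C}, topologicalKrullDim C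

universe u

theorem Algebra.IsIntegral.ringKrullDim_eq (R S : Type*) [CommRing R] [CommRing S] [Algebra R S]
    [Algebra.IsIntegral R S] [FaithfulSMul R S] : ringKrullDim R = ringKrullDim S := by
  refine le_antisymm (iSup_le fun l ↦ ?_) ?_
  · obtain ⟨Q, hQ⟩ := (algebraMap_isIntegral_iff.mpr ‹_›).comap_surjective
      (FaithfulSMul.algebraMap_injective R S) l.head
    have : Q.asIdeal.LiesOver l.head.asIdeal := ⟨by rw [← hQ]; rfl⟩
    obtain ⟨L, hL, -⟩ := Ideal.exists_ltSeries_of_hasGoingUp l Q.asIdeal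
    exact hL ▸ Order.LTSeries.length_le_krullDim L
  · exact Order.krullDim_le_of_strictMono (PrimeSpectrum.comap (algebraMap R S))
      fun _ _ h ↦ Ideal.IsIntegral.comap_lt_comap h

theorem ringKrullDim_eq_toENat_trdeg (k R : Type u) [Field k] [CommRing R] [IsDomain R]
    [Algebra k R] [Algebra.FiniteType k R] :
    ringKrullDim R = (Cardinal.toENat (Algebra.trdeg k R) : WithBot ℕ∞) := by
  obtain ⟨s, g, hg, hint⟩ := exists_integral_inj_algHom_of_fg k R
  let := g.toRingHom.toAlgebra
  have : IsScalarTower k (MvPolynomial (Fin s) k) R := .of_algHom g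
  have : Algebra.IsIntegral (MvPolynomial (Fin s) k) R := ⟨hint⟩
  have : FaithfulSMul (MvPolynomial (Fin s) k) R :=
    (faithfulSMul_iff_algebraMap_injective _ _).mpr hg
  rw [← Algebra.IsIntegral.ringKrullDim_eq (MvPolynomial (Fin s) k) R,
    MvPolynomial.ringKrullDim_of_isNoetherianRing, ringKrullDim_eq_zero_of_field,
    ← trdeg_add_eq k (MvPolynomial (Fin s) k) (A := R),
    trdeg_eq_zero (R := MvPolynomial (Fin s) k)]
  simp

theorem ringKrullDim_eq_add_ringKrullDim_localization (k B A : Type u) [Field k] [CommRing B]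
    [IsDomain B] [CommRing A] [IsDomain A] [Algebra k B] [Algebra B A] [FaithfulSMul B A]
    [Algebra.FiniteType k B] [Algebra.FiniteType B A] :
    ringKrullDim A = ringKrullDim B +
      ringKrullDim (Localization (Algebra.algebraMapSubmonoid A (nonZeroDivisors B))) := by
  let M := Algebra.algebraMapSubmonoid A (nonZeroDivisors B)
  let : Algebra k A := ((algebraMap B A).comp (algebraMap k B)).toAlgebra
  have : IsScalarTower k B A := .of_algebraMap_eq' rfl
  have : Algebra.FiniteType k A := .trans (S := B) inferInstance inferInstance
  have hMle : M ≤ nonZeroDivisors A :=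
    map_le_nonZeroDivisors_of_injective _ (FaithfulSMul.algebraMap_injective B A) le_rfl
  have : IsDomain (Localization M) := IsLocalization.isDomain_localization hMle
  let K := FractionRing B
  have : Algebra.FiniteType K (Localization M) := by
    have : IsLocalization ((nonZeroDivisors B).map (algebraMap B A)) (Localization M) :=
      inferInstanceAs (IsLocalization M (Localization M))
    have h := RingHom.finiteType_localizationPreserves (algebraMap B A) (nonZeroDivisors B)
      K (Localization M) (RingHom.finiteType_algebraMap.mpr ‹_›)
    exact RingHom.finiteType_algebraMap.mp h
  have : FaithfulSMul A (Localization M) := (faithfulSMul_iff_algebraMap_injective _ _).mpr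
    (IsLocalization.injective _ hMle)
  have : FaithfulSMul K (Localization M) :=
    (faithfulSMul_iff_algebraMap_injective _ _).mpr (algebraMap K _).injective
  have : IsScalarTower k B (Localization M) := .of_algebraMap_eq fun x ↦ by
    rw [IsScalarTower.algebraMap_apply k A, IsScalarTower.algebraMap_apply B A]; rfl
  have : IsScalarTower k K (Localization M) := .to₁₃₄ k B K (Localization M)
  have : Algebra.IsAlgebraic A (Localization M) := IsLocalization.isAlgebraic _ M
  have : Algebra.IsAlgebraic B K := IsLocalization.isAlgebraic _ (nonZeroDivisors B)
  rw [ringKrullDim_eq_toENat_trdeg k A, ringKrullDim_eq_toENat_trdeg k B,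
    ringKrullDim_eq_toENat_trdeg K (Localization M), ← WithBot.coe_add, ← map_add]
  congr 2
  have h1 := trdeg_add_eq k A (A := Localization M)
  have h2 := trdeg_add_eq k B (A := K)
  have h3 := trdeg_add_eq k K (A := Localization M)
  rw [trdeg_eq_zero (R := A), add_zero] at h1
  rw [trdeg_eq_zero (R := B), add_zero] at h2
  rw [h1, h2, h3]

theorem Topology.IsInducing.topologicalKrullDim_le_of_range_subset {S T X : Type*}
    [TopologicalSpace S] [TopologicalSpace T] [TopologicalSpace X] {i : S → X} {j : T → X}
    (hi : IsInducing i) (hj : IsInducing j) (h : Set.range i ⊆ Set.range j) :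
    topologicalKrullDim S ≤ topologicalKrullDim T := by
  choose g hg using fun s ↦ h ⟨s, rfl⟩
  have hgi : j ∘ g = i := funext hg
  exact (hj.of_comp_iff.mp (hgi ▸ hi)).topologicalKrullDim_le

theorem topologicalKrullDim_le_of_openCover {X ι : Type*} [TopologicalSpace X] (U : ι → Set X)
    (hU : ∀ i, IsOpen (U i)) (hcover : ∀ x, ∃ i, x ∈ U i) {n : WithBot ℕ∞}
    (h : ∀ i, topologicalKrullDim (U i) ≤ n) : topologicalKrullDim X ≤ n := by
  refine iSup_le fun l ↦ ?_
  obtain ⟨x, hx⟩ := l.head.isIrreducible.nonempty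
  obtain ⟨i, hi⟩ := hcover x
  let e := TopologicalSpace.IrreducibleCloseds.orderIsoOfIsOpenEmbedding
    (Subtype.val : U i → X) (hU i).isOpenEmbedding_subtypeVal
  let l' : LTSeries (TopologicalSpace.IrreducibleCloseds (U i)) :=
    { length := l.length
      toFun := fun j ↦ e.symm ⟨l j, ⟨x, hi⟩, LTSeries.head_le l j hx⟩
      step := fun j ↦ e.symm.strictMono (l.step j) }
  exact (Order.LTSeries.length_le_krullDim l').trans (h i)

theorem topologicalKrullDim_lt_of_isClosed {Y : Type*} [TopologicalSpace Y] [IrreducibleSpace Y]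
    {C : Set Y} (hC : IsClosed C) (hCuniv : C ≠ Set.univ)
    (hfin : topologicalKrullDim Y < ⊤) : topologicalKrullDim C < topologicalKrullDim Y := by
  by_contra! hle
  let Yuniv : TopologicalSpace.IrreducibleCloseds Y :=
    ⟨Set.univ, IrreducibleSpace.isIrreducible_univ Y, isClosed_univ⟩
  have : Nonempty (TopologicalSpace.IrreducibleCloseds Y) := ⟨Yuniv⟩
  have hfd : FiniteDimensionalOrder (TopologicalSpace.IrreducibleCloseds Y) :=
    Order.finiteDimensionalOrder_iff_krullDim_ne_bot_and_top.mpr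
      ⟨Order.krullDim_ne_bot_iff.mpr this, hfin.ne⟩
  have hY : topologicalKrullDim Y = _ := Order.krullDim_eq_length_of_finiteDimensionalOrder
  obtain ⟨l, hl⟩ := Order.le_krullDim_iff.mp (hY ▸ hle)
  have hmono : StrictMono (TopologicalSpace.IrreducibleCloseds.map (Subtype.val : C → Y)
      continuous_subtype_val) :=
    TopologicalSpace.IrreducibleCloseds.map_strictMono_of_isInducing .subtypeVal
  have hlast : (l.map _ hmono).last < Yuniv := by
    refine lt_of_le_of_ne (fun _ _ ↦ trivial) fun h ↦ hCuniv (Set.eq_univ_of_univ_subset ?_)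
    have h' : closure (Subtype.val '' (l.last : Set C)) = (Set.univ : Set Y) :=
      congrArg (fun T : TopologicalSpace.IrreducibleCloseds Y ↦ (T : Set Y)) h
    exact h' ▸ closure_minimal (Subtype.coe_image_subset C _) hC
  have := Order.LTSeries.length_le_krullDim ((l.map _ hmono).snoc Yuniv hlast)
  have h : ((l.length + 1 : ℕ) : WithBot ℕ∞) ≤ topologicalKrullDim Y := this
  rw [hY, hl, Nat.cast_le] at h
  omega

theorem topologicalKrullDim_closure_singleton_le_localDim {X : Type*} [TopologicalSpace X] (x : X) :
    topologicalKrullDim (closure {x} : Set X) ≤ localDim X x := by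
  refine le_trans ?_ (le_iSup₂ (irreducibleComponent x)
    ⟨irreducibleComponent_mem_irreducibleComponents x, mem_irreducibleComponent⟩)
  refine IsInducing.subtypeVal.topologicalKrullDim_le_of_range_subset
    IsInducing.subtypeVal ?_
  simpa [isClosed_irreducibleComponent.closure_subset_iff] using mem_irreducibleComponent

theorem PrimeSpectrum.topologicalKrullDim_closure_singleton {R : Type*} [CommRing R]
    (P : PrimeSpectrum R) :
    topologicalKrullDim (closure {P} : Set (PrimeSpectrum R)) = ringKrullDim (R ⧸ P.asIdeal) := by
  have hi := (PrimeSpectrum.isClosedEmbedding_comap_of_surjective _ _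
    (Ideal.Quotient.mk_surjective (I := P.asIdeal))).isInducing
  have hr : Set.range (PrimeSpectrum.comap (Ideal.Quotient.mk P.asIdeal)) =
      Set.range (Subtype.val : (closure {P} : Set (PrimeSpectrum R)) → _) := by
    rw [range_comap_of_surjective _ _ Ideal.Quotient.mk_surjective]
    simp [PrimeSpectrum.closure_singleton]
    rfl
  rw [← PrimeSpectrum.topologicalKrullDim_eq_ringKrullDim]
  exact le_antisymm (IsInducing.subtypeVal.topologicalKrullDim_le_of_range_subset hi hr.ge)
    (hi.topologicalKrullDim_le_of_range_subset IsInducing.subtypeVal hr.le)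

theorem PrimeSpectrum.topologicalKrullDim_closure_le_add (k B A : Type u) [Field k] [CommRing B]
    [CommRing A] [Algebra k B] [Algebra B A] [Algebra.FiniteType k B] [Algebra.FiniteType B A]
    (P : PrimeSpectrum A) :
    topologicalKrullDim (closure {P} : Set (PrimeSpectrum A)) ≤
      topologicalKrullDim (closure {comap (algebraMap B A) P} : Set (PrimeSpectrum B)) +
      topologicalKrullDim ↑(closure {P} ∩
        comap (algebraMap B A) ⁻¹' {comap (algebraMap B A) P} : Set (PrimeSpectrum A)) := by
  set p := P.asIdeal
  let q := p.under B
  have hq : (comap (algebraMap B A) P).asIdeal = q := rfl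
  have : Algebra.FiniteType k (B ⧸ q) := .trans (S := B) inferInstance inferInstance
  have : Algebra.FiniteType B (A ⧸ p) := .trans (S := A) inferInstance inferInstance
  have : Algebra.FiniteType (B ⧸ q) (A ⧸ p) := .of_restrictScalars_finiteType B _ _
  have : FaithfulSMul (B ⧸ q) (A ⧸ p) := inferInstance
  let M := Algebra.algebraMapSubmonoid (A ⧸ p) (nonZeroDivisors (B ⧸ q))
  rw [topologicalKrullDim_closure_singleton, topologicalKrullDim_closure_singleton, hq,
    ringKrullDim_eq_add_ringKrullDim_localization k (B ⧸ q) (A ⧸ p)]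
  gcongr
  rw [← PrimeSpectrum.topologicalKrullDim_eq_ringKrullDim]
  refine ((isEmbedding_comap_of_surjective _ _
    (Ideal.Quotient.mk_surjective (I := p))).isInducing.comp
      (localization_comap_isEmbedding (Localization M) M).isInducing)
      |>.topologicalKrullDim_le_of_range_subset IsInducing.subtypeVal ?_
  rintro _ ⟨R, rfl⟩
  rw [Subtype.range_val]
  set R' := comap (algebraMap (A ⧸ p) (Localization M)) R with hR'
  have hdisj : Disjoint (M : Set (A ⧸ p)) R'.asIdeal :=
    (localization_comap_range (Localization M) M).le ⟨R, rfl⟩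
  have hle : P ≤ comap (Ideal.Quotient.mk p) R' := fun x hx ↦ by
    change Ideal.Quotient.mk p x ∈ R'.asIdeal
    rw [Ideal.Quotient.eq_zero_iff_mem.mpr hx]
    exact zero_mem _
  refine ⟨(le_iff_mem_closure _ _).mp hle, le_antisymm ?_ (Ideal.comap_mono hle)⟩
  intro b hb
  by_contra hbq
  have hbM : algebraMap (B ⧸ q) (A ⧸ p) (Ideal.Quotient.mk q b) ∈ (M : Set (A ⧸ p)) :=
    ⟨_, mem_nonZeroDivisors_of_ne_zero (mt Ideal.Quotient.eq_zero_iff_mem.mp hbq), rfl⟩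
  exact Set.disjoint_left.mp hdisj hbM hb

theorem AlgebraicGeometry.Scheme.Hom.exists_finiteType_ringHom_of_isAffineOpen {k : Type u}
    [Field k] {Y : Scheme.{u}} (sY : Y ⟶ Spec (CommRingCat.of k)) [LocallyOfFiniteType sY]
    {V : Y.Opens} (hV : IsAffineOpen V) : ∃ φ : k →+* Γ(Y, V), φ.FiniteType :=
  ⟨(sY.appLE ⊤ V le_top).hom.comp (Scheme.ΓSpecIso (.of k)).inv.hom,
    (sY.finiteType_appLE (isAffineOpen_top _) hV le_top).comp
      (.of_surjective _ (Scheme.ΓSpecIso (.of k)).commRingCatIsoToRingEquiv.symm.surjective)⟩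

theorem AlgebraicGeometry.Scheme.Hom.topologicalKrullDim_closure_inter_le_add {k : Type u}
    [Field k] {X Y : Scheme.{u}} (f : X ⟶ Y) (sY : Y ⟶ Spec (CommRingCat.of k))
    [LocallyOfFiniteType sY] [LocallyOfFiniteType f] {U : X.Opens} {V : Y.Opens}
    (hU : IsAffineOpen U) (hV : IsAffineOpen V) (e : U ≤ f ⁻¹ᵁ V) {z : X} (hz : z ∈ U) :
    topologicalKrullDim ↑(closure {z} ∩ U : Set X) ≤
      topologicalKrullDim (closure {f z} : Set Y) +
      topologicalKrullDim ↑(closure {z} ∩ f ⁻¹' {f z} : Set X) := by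
  obtain ⟨φ, hφ⟩ := sY.exists_finiteType_ringHom_of_isAffineOpen hV
  let : Algebra k Γ(Y, V) := φ.toAlgebra
  let : Algebra Γ(Y, V) Γ(X, U) := (f.appLE V U e).hom.toAlgebra
  have : Algebra.FiniteType k Γ(Y, V) := hφ
  have : Algebra.FiniteType Γ(Y, V) Γ(X, U) := f.finiteType_appLE hV hU e
  set P := hU.primeIdealOf ⟨z, hz⟩
  set Q := hV.primeIdealOf ⟨f z, e hz⟩
  have hPQ : PrimeSpectrum.comap (algebraMap Γ(Y, V) Γ(X, U)) P = Q :=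
    IsAffineOpen.comap_primeIdealOf_appLE V hV U hU e hz
  have hP : hU.fromSpec P = z := hU.fromSpec_primeIdealOf ⟨z, hz⟩
  have hQ : hV.fromSpec Q = f z := hV.fromSpec_primeIdealOf ⟨f z, e hz⟩
  have hUi : IsInducing hU.fromSpec := hU.fromSpec.isOpenEmbedding.isInducing
  have hVi : IsInducing hV.fromSpec := hV.fromSpec.isOpenEmbedding.isInducing
  have key := PrimeSpectrum.topologicalKrullDim_closure_le_add k Γ(Y, V) Γ(X, U) P
  rw [hPQ] at key
  refine le_trans ?_ (key.trans (add_le_add ?_ ?_))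
  · refine IsInducing.subtypeVal.topologicalKrullDim_le_of_range_subset
      (hUi.comp IsInducing.subtypeVal) ?_
    rintro _ ⟨⟨x, hxz, hxU⟩, rfl⟩
    obtain ⟨R, rfl⟩ : x ∈ Set.range hU.fromSpec := by rwa [hU.range_fromSpec]
    refine ⟨⟨R, ?_⟩, rfl⟩
    rw [← hP] at hxz
    exact specializes_iff_mem_closure.mp (hUi.specializes_iff.mp
      (specializes_iff_mem_closure.mpr hxz))
  · refine (hVi.comp IsInducing.subtypeVal).topologicalKrullDim_le_of_range_subset
      IsInducing.subtypeVal ?_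
    rintro _ ⟨⟨R, hR⟩, rfl⟩
    refine ⟨⟨hV.fromSpec R, ?_⟩, rfl⟩
    rw [← hQ]
    exact ((specializes_iff_mem_closure.mpr hR).map hVi.continuous).mem_closure
  · refine (hUi.comp IsInducing.subtypeVal).topologicalKrullDim_le_of_range_subset
      IsInducing.subtypeVal ?_
    rintro _ ⟨⟨R, hR, hRQ⟩, rfl⟩
    refine ⟨⟨hU.fromSpec R, ?_, ?_⟩, rfl⟩
    · rw [← hP]
      exact ((specializes_iff_mem_closure.mpr hR).map hUi.continuous).mem_closure
    · rw [Set.mem_preimage, Set.mem_singleton_iff, ← hQ, ← Set.mem_singleton_iff.mp hRQ,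
        ← Scheme.Hom.comp_apply, ← hV.SpecMap_appLE_fromSpec f hU e]
      rfl

theorem AlgebraicGeometry.Scheme.Hom.topologicalKrullDim_closure_le_add {k : Type u} [Field k]
    {X Y : Scheme.{u}} (f : X ⟶ Y) (sY : Y ⟶ Spec (CommRingCat.of k)) [LocallyOfFiniteType sY]
    [LocallyOfFiniteType f] (z : X) :
    topologicalKrullDim (closure {z} : Set X) ≤
      topologicalKrullDim (closure {f z} : Set Y) +
      topologicalKrullDim ↑(closure {z} ∩ f ⁻¹' {f z} : Set X) := by
  have h (x : X) : ∃ (U : X.Opens) (V : Y.Opens), x ∈ U ∧ IsAffineOpen U ∧ IsAffineOpen V ∧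
      U ≤ f ⁻¹ᵁ V := by
    obtain ⟨V, hV, hxV, -⟩ := exists_isAffineOpen_mem_and_subset (U := ⊤) (x := f x) trivial
    obtain ⟨U, hU, hxU, e⟩ := exists_isAffineOpen_mem_and_subset (U := f ⁻¹ᵁ V) (x := x) hxV
    exact ⟨U, V, hxU, hU, hV, e⟩
  choose U V hxU hU hV e using h
  refine topologicalKrullDim_le_of_openCover
    (fun x : (closure {z} : Set X) ↦ Subtype.val ⁻¹' (U x : Set X))
    (fun x ↦ (U x).isOpen.preimage continuous_subtype_val) (fun x ↦ ⟨x, hxU x⟩) fun x ↦ ?_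
  refine le_trans ?_ (f.topologicalKrullDim_closure_inter_le_add sY (hU x) (hV x) (e x)
    ((specializes_iff_mem_closure.mpr x.2).mem_open (U x).isOpen (hxU x)))
  refine (IsInducing.subtypeVal.comp IsInducing.subtypeVal).topologicalKrullDim_le_of_range_subset
    IsInducing.subtypeVal ?_
  rintro _ ⟨⟨y, hy⟩, rfl⟩
  exact ⟨⟨y, y.2, hy⟩, rfl⟩

theorem AlgebraicGeometry.IsAffineOpen.exists_topologicalKrullDim_le {k : Type u} [Field k]
    {W : Scheme.{u}} (s : W ⟶ Spec (CommRingCat.of k)) [LocallyOfFiniteType s] {U : W.Opens}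
    (hU : IsAffineOpen U) : ∃ n : ℕ, topologicalKrullDim (U : Set W) ≤ n := by
  obtain ⟨φ, hφ⟩ := s.exists_finiteType_ringHom_of_isAffineOpen hU
  let : Algebra k Γ(W, U) := φ.toAlgebra
  have : Algebra.FiniteType k Γ(W, U) := hφ
  obtain ⟨n, g, hg⟩ := Algebra.FiniteType.iff_quotient_mvPolynomial''.mp this
  refine ⟨n, ?_⟩
  calc topologicalKrullDim (U : Set W)
      ≤ topologicalKrullDim (PrimeSpectrum Γ(W, U)) :=
        IsInducing.subtypeVal.topologicalKrullDim_le_of_range_subset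
          hU.fromSpec.isOpenEmbedding.isInducing (Subtype.range_val.trans hU.range_fromSpec.symm).le
    _ = ringKrullDim Γ(W, U) := PrimeSpectrum.topologicalKrullDim_eq_ringKrullDim _
    _ ≤ ringKrullDim (MvPolynomial (Fin n) k) := ringKrullDim_le_of_surjective g.toRingHom hg
    _ = n := by simp [MvPolynomial.ringKrullDim_of_isNoetherianRing]

theorem AlgebraicGeometry.topologicalKrullDim_lt_top {k : Type u} [Field k] {W : Scheme.{u}}
    (s : W ⟶ Spec (CommRingCat.of k)) [LocallyOfFiniteType s] [CompactSpace W] :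
    topologicalKrullDim W < ⊤ := by
  have h (x : W) : ∃ (U : W.Opens) (n : ℕ), x ∈ U ∧ topologicalKrullDim (U : Set W) ≤ n := by
    obtain ⟨U, hU, hx, -⟩ := exists_isAffineOpen_mem_and_subset (U := ⊤) (x := x) trivial
    exact ⟨U, _, hx, (hU.exists_topologicalKrullDim_le s).choose_spec⟩
  choose U n hx hn using h
  obtain ⟨t, ht⟩ := CompactSpace.elim_nhds_subcover (fun x ↦ (U x : Set W))
    fun x ↦ (U x).isOpen.mem_nhds (hx x)
  have : topologicalKrullDim W ≤ (t.sup n : ℕ) := by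
    refine topologicalKrullDim_le_of_openCover (fun x : t ↦ (U x : Set W))
      (fun x ↦ (U x).isOpen) (fun x ↦ ?_) fun x ↦ ?_
    · simpa using ht.ge (Set.mem_univ x)
    · exact (hn x).trans (Nat.cast_le.mpr (Finset.le_sup x.2))
  exact this.trans_lt (WithBot.coe_lt_coe.mpr (ENat.natCast_lt_top _))

theorem Topology.IsConstructible.exists_isOpen_subset_or_subset_compl {X : Type*}
    [TopologicalSpace X] [IrreducibleSpace X] {s : Set X} (hs : IsConstructible s) :
    ∃ U : Set X, IsOpen U ∧ U.Nonempty ∧ (U ⊆ s ∨ U ⊆ sᶜ) := by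
  induction hs using IsConstructible.empty_union_induction with
  | open_retrocompact U hU _ =>
    rcases U.eq_empty_or_nonempty with rfl | hne
    · exact ⟨Set.univ, isOpen_univ, Set.univ_nonempty, .inr (by simp)⟩
    · exact ⟨U, hU, hne, .inl subset_rfl⟩
  | union s _ t _ hs ht =>
    obtain ⟨U, hU, hUne, hUs⟩ := hs
    obtain ⟨V, hV, hVne, hVt⟩ := ht
    refine ⟨U ∩ V, hU.inter hV, nonempty_preirreducible_inter hU hV hUne hVne, ?_⟩
    rcases hUs with h | hUs
    · exact .inl ((Set.inter_subset_left.trans h).trans Set.subset_union_left)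
    rcases hVt with h | hVt
    · exact .inl ((Set.inter_subset_right.trans h).trans Set.subset_union_right)
    · exact .inr (Set.compl_union s t ▸ Set.inter_subset_inter hUs hVt)
  | compl s _ hs => simpa [or_comm] using hs

theorem localDim_le_topologicalKrullDim {X : Type*} [TopologicalSpace X] (x : X) :
    localDim X x ≤ topologicalKrullDim X :=
  iSup₂_le fun _ _ ↦ IsInducing.subtypeVal.topologicalKrullDim_le

theorem localDim_ne_bot {X : Type*} [TopologicalSpace X] (x : X) : localDim X x ≠ ⊥ :=
  ne_bot_of_le_ne_bot (Order.krullDim_ne_bot_iff.mpr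
    ⟨⟨closure {⟨x, subset_closure rfl⟩}, isIrreducible_singleton.closure, isClosed_closure⟩⟩)
    (topologicalKrullDim_closure_singleton_le_localDim x)

theorem topologicalKrullDim_le_localDim {X : Type*} [TopologicalSpace X] [IrreducibleSpace X]
    (x : X) : topologicalKrullDim X ≤ localDim X x := by
  refine le_trans ?_ (le_iSup₂ (irreducibleComponent x)
    ⟨irreducibleComponent_mem_irreducibleComponents x, mem_irreducibleComponent⟩)
  refine IsInducing.id.topologicalKrullDim_le_of_range_subset IsInducing.subtypeVal ?_
  rw [Set.range_id, Subtype.range_val]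
  exact (eq_irreducibleComponent (PreirreducibleSpace.isPreirreducible_univ)
    (Set.subset_univ _)).le

theorem localDim_le_of_closure_mem_irreducibleComponents {X : Type*} [TopologicalSpace X] {x : X}
    (hx : closure {x} ∈ irreducibleComponents X) :
    localDim X x ≤ topologicalKrullDim (closure {x} : Set X) := by
  refine iSup₂_le fun C ⟨hC, hxC⟩ ↦ ?_
  refine IsInducing.subtypeVal.topologicalKrullDim_le_of_range_subset IsInducing.subtypeVal ?_
  simp only [Subtype.range_val]
  refine hx.2 hC.1 ?_
  rwa [(isClosed_of_mem_irreducibleComponents C hC).closure_subset_iff,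
    Set.singleton_subset_iff]

theorem WithBot.exists_eq_natCast_of_ne_bot_of_lt_top {a : WithBot ℕ∞} (h : a ≠ ⊥) (h' : a < ⊤) :
    ∃ n : ℕ, a = n := by
  lift a to ℕ∞ using h
  lift a to ℕ using (WithBot.coe_lt_coe.mp h').ne
  exact ⟨a, rfl⟩

theorem AlgebraicGeometry.Scheme.Hom.closure_singleton_eq_univ_of_localDim_le {k : Type u}
    [Field k] {X Y : Scheme.{u}} (f : X ⟶ Y) (sY : Y ⟶ Spec (CommRingCat.of k))
    [LocallyOfFiniteType sY] [CompactSpace Y] [LocallyOfFiniteType f] [QuasiCompact f]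
    [IrreducibleSpace Y] {z : X} (hz : closure {z} ∈ irreducibleComponents X)
    (h : localDim (f ⁻¹' {f z} : Set X) ⟨z, rfl⟩ + localDim Y (f z) ≤ localDim X z) :
    closure {f z} = Set.univ := by
  by_contra hne
  have : CompactSpace X := QuasiCompact.compactSpace_of_compactSpace f
  have hlt := topologicalKrullDim_lt_of_isClosed isClosed_closure hne
    (topologicalKrullDim_lt_top sY)
  have hD := (localDim_le_topologicalKrullDim (⟨z, rfl⟩ : (f ⁻¹' {f z} : Set X))).trans
    IsInducing.subtypeVal.topologicalKrullDim_le
  have hfib : topologicalKrullDim ↑(closure {z} ∩ f ⁻¹' {f z} : Set X) ≤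
      localDim (f ⁻¹' {f z} : Set X) ⟨z, rfl⟩ := by
    refine le_trans ?_ (topologicalKrullDim_closure_singleton_le_localDim _)
    refine IsInducing.subtypeVal.topologicalKrullDim_le_of_range_subset
      (IsInducing.subtypeVal.comp IsInducing.subtypeVal) ?_
    rintro _ ⟨⟨x, hxz, hx⟩, rfl⟩
    refine ⟨⟨⟨x, hx⟩, ?_⟩, rfl⟩
    exact specializes_iff_mem_closure.mp (IsInducing.subtypeVal.specializes_iff.mp
      (specializes_iff_mem_closure.mpr hxz))
  obtain ⟨d, hd⟩ := WithBot.exists_eq_natCast_of_ne_bot_of_lt_top (localDim_ne_bot _)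
    (hD.trans_lt (topologicalKrullDim_lt_top (f ≫ sY)))
  have hle := calc
    (d : WithBot ℕ∞) + topologicalKrullDim Y
      ≤ localDim (f ⁻¹' {f z} : Set X) ⟨z, rfl⟩ + localDim Y (f z) :=
        add_le_add hd.ge (topologicalKrullDim_le_localDim _)
    _ ≤ topologicalKrullDim (closure {z} : Set X) :=
        h.trans (localDim_le_of_closure_mem_irreducibleComponents hz)
    _ ≤ topologicalKrullDim (closure {f z} : Set Y) + d :=
        (f.topologicalKrullDim_closure_le_add sY z).trans (add_le_add le_rfl (hfib.trans hd.le))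
  obtain ⟨a, ha⟩ := WithBot.exists_eq_natCast_of_ne_bot_of_lt_top (ne_bot_of_gt hlt)
    (topologicalKrullDim_lt_top sY)
  generalize topologicalKrullDim (closure {f z} : Set Y) = c at hlt hle
  rw [ha] at hlt hle
  induction c with
  | bot => simp [← Nat.cast_add] at hle
  | coe c =>
    lift c to ℕ using ((WithBot.coe_lt_coe.mp hlt).trans (ENat.natCast_lt_top _)).ne
    change ((d : WithBot ℕ∞) + a) ≤ ((c : ℕ) : WithBot ℕ∞) + d at hle
    change ((c : ℕ) : WithBot ℕ∞) < a at hlt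
    norm_cast at hle hlt
    omega

/-- Let `Y` be an irreducible scheme of finite type over a field `k` and `f : X ⟶ Y`
a morphism of finite type with `X` nonempty. If `dim_z X − dim_{f z} Y = dim_z f⁻¹(f z)`
for all `z ∈ X` (written additively), then there is an open dense `U ⊆ Y` all of whose
points have nonempty fiber. -/
theorem statement12 {k : Type} [Field k]
    (X Y : Scheme) (f : X ⟶ Y)
    (sY : Y ⟶ Spec (CommRingCat.of k))
    [LocallyOfFiniteType sY] [CompactSpace Y]
    [LocallyOfFiniteType f] [QuasiCompact f]
    [Nonempty X] [IrreducibleSpace Y]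
    (heq : ∀ z : X,
      localDim X z =
        localDim (f.base ⁻¹' {f.base z} : Set X) ⟨z, rfl⟩ + localDim Y (f.base z)) :
    ∃ U : Set Y, IsOpen U ∧ Dense U ∧ ∀ y ∈ U, (f.base ⁻¹' {y}).Nonempty := by
  obtain ⟨z, hz⟩ := QuasiSober.sober
    (isIrreducible_irreducibleComponent (x := Classical.arbitrary X)) isClosed_irreducibleComponent
  have hgen : closure {f z} = Set.univ := by
    refine f.closure_singleton_eq_univ_of_localDim_le sY ?_ (heq z).ge
    exact hz.def ▸ irreducibleComponent_mem_irreducibleComponents _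
  have : IsLocallyNoetherian Y := LocallyOfFiniteType.isLocallyNoetherian sY
  have : LocallyOfFinitePresentation f :=
    LocallyOfFinitePresentation.iff_locallyOfFiniteType.mpr inferInstance
  obtain ⟨U, hU, hUne, hUr⟩ :=
    (f.isConstructible_image .univ).exists_isOpen_subset_or_subset_compl
  have hzU : f z ∈ U := (isGenericPoint_def.mpr hgen).mem_open_set_iff hU |>.mpr (by simpa)
  refine ⟨U, hU, hU.dense hUne, fun y hy ↦ ?_⟩
  rcases hUr with hUr | hUr
  · obtain ⟨x, -, hx⟩ := hUr hy
    exact ⟨x, hx⟩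
  · exact absurd ⟨z, trivial, rfl⟩ (hUr hzU)
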